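/- Let (S,T) be a finite Markov chain and A, B ⊆ S. The least fixed point of the monotone map X ↦ B ∪ (A ∩ Pre_{≥1}(X)) equals the set of states s such that every positive path π from s satisfies the until condition: there exists i ∈ ℕ with π i ∈ B and π j ∈ A for all j < i. (This shows that the PμTL formula μZ.(b ∨ (a ∧ X^{≥1}Z)) holds at s exactly when a U b holds along every path from s.) -/

import Mathlib

/-- `Pre_{≥p}(X)`: states from which the one-step probability of moving into `X`
is at least `p`. -/
def PreGe {S : Type} [Fintype S] (T : S → S → ℝ) (p : ℝ) (X : Set S) : Set S :=
  {s | p ≤ ∑ s' : S, X.indicator (T s) s'}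

/-- `Pre_{>p}(X)`: states from which the one-step probability of moving into `X`
is strictly greater than `p`. -/
def PreGt {S : Type} [Fintype S] (T : S → S → ℝ) (p : ℝ) (X : Set S) : Set S :=
  {s | p < ∑ s' : S, X.indicator (T s) s'}

theorem mem_PreGe_one_iff {S : Type} [Fintype S] (T : S → S → ℝ)
    (hT0 : ∀ s s', 0 ≤ T s s') (hT1 : ∀ s, ∑ s' : S, T s s' = 1) (X : Set S) (s : S) :
    s ∈ PreGe T 1 X ↔ ∀ s', 0 < T s s' → s' ∈ X := by
  have hle : ∀ s' ∈ Finset.univ, X.indicator (T s) s' ≤ T s s' := fun s' _ =>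
    Set.indicator_le_self' (fun _ _ => hT0 s _) s'
  constructor
  · intro h s' hs'
    by_contra hn
    have hlt : ∑ s' : S, X.indicator (T s) s' < ∑ s' : S, T s s' :=
      Finset.sum_lt_sum hle ⟨s', Finset.mem_univ _, by simpa [hn] using hs'⟩
    rw [hT1] at hlt
    exact absurd h (not_le.mpr hlt)
  · intro h
    have heq : ∑ s' : S, X.indicator (T s) s' = ∑ s' : S, T s s' := by
      refine Finset.sum_congr rfl fun s' _ => ?_
      by_cases hx : s' ∈ X
      · simp [hx]
      · have h0 : T s s' = 0 := le_antisymm (not_lt.mp fun hp => hx (h s' hp)) (hT0 s s')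
        simp [hx, h0]
    change (1 : ℝ) ≤ ∑ s' : S, X.indicator (T s) s'
    rw [heq, hT1]

/-- In a finite Markov chain `(S,T)` with `A, B ⊆ S`, the least fixed point of the
monotone map `X ↦ B ∪ (A ∩ Pre_{≥1}(X))` equals the set of states `s` such that
every positive path `π` from `s` satisfies the until condition: some `i` has
`π i ∈ B` with `π j ∈ A` for all `j < i`. Thus `μZ.(b ∨ (a ∧ X^{≥1}Z))` holds at
`s` exactly when `a U b` holds along every path from `s`. -/
theorem lfp_sure_until (S : Type) [Fintype S] [Nonempty S]
    (T : S → S → ℝ)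
    (hT0 : ∀ s s', 0 ≤ T s s') (hT1 : ∀ s, ∑ s' : S, T s s' = 1)
    (A B : Set S)
    (F : Set S →o Set S)
    (hF : ∀ X, F X = B ∪ (A ∩ PreGe T 1 X)) :
    OrderHom.lfp F =
      {s : S | ∀ π : ℕ → S, π 0 = s → (∀ i, 0 < T (π i) (π (i + 1))) →
        ∃ i, π i ∈ B ∧ ∀ j < i, π j ∈ A} := by
  apply le_antisymm
  · apply OrderHom.lfp_le
    rw [hF]
    rintro s (hB | ⟨hA, hP⟩) π h0 hπ
    · exact ⟨0, by rwa [h0], by simp⟩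
    · rw [mem_PreGe_one_iff T hT0 hT1] at hP
      have h1 : 0 < T s (π 1) := by
        have := hπ 0
        rwa [h0] at this
      obtain ⟨i, hi, hj⟩ := hP _ h1 (fun n => π (n + 1)) rfl (fun n => hπ (n + 1))
      refine ⟨i + 1, hi, fun j hji => ?_⟩
      cases j with
      | zero => rwa [h0]
      | succ j => exact hj j (by omega)
  · intro s hs
    by_contra hn
    have hfix : OrderHom.lfp F = B ∪ (A ∩ PreGe T 1 (OrderHom.lfp F)) := by
      rw [← hF, OrderHom.map_lfp]
    generalize OrderHom.lfp F = L at hn hfix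
    have hstep : ∀ s, ∃ s', 0 < T s s' ∧ (s ∉ L → s ∈ A → s' ∉ L) := by
      intro s
      by_cases hc : s ∉ L ∧ s ∈ A
      · have hnp : s ∉ PreGe T 1 L := fun hp => hc.1 (by rw [hfix]; exact Or.inr ⟨hc.2, hp⟩)
        rw [mem_PreGe_one_iff T hT0 hT1] at hnp
        push Not at hnp
        obtain ⟨s', h1, h2⟩ := hnp
        exact ⟨s', h1, fun _ _ => h2⟩
      · obtain ⟨s', -, h⟩ : ∃ s' ∈ Finset.univ, 0 < T s s' := by
          apply Finset.exists_lt_of_sum_lt (f := fun _ => (0 : ℝ))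
          simp [hT1]
        exact ⟨s', h, fun a b => absurd ⟨a, b⟩ hc⟩
    choose g hg1 hg2 using hstep
    obtain ⟨i, hi, hj⟩ := hs (fun n => g^[n] s) rfl (fun n => by
      simp only [Function.iterate_succ_apply']
      exact hg1 _)
    have hall : ∀ k ≤ i, g^[k] s ∉ L := by
      intro k
      induction k with
      | zero => intro _; exact hn
      | succ k ih =>
        intro hk
        rw [Function.iterate_succ_apply']
        exact hg2 _ (ih (by omega)) (hj k (by omega))
    exact hall i le_rfl (by rw [hfix]; exact Or.inl hi)
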